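/- In a happy temporal graph (non-strict setting), every bi-path between two distinct vertices has an underlying path of length one, i.e., consists of a single edge. -/

import Mathlib

namespace TemporalPaper

/-- A temporal graph on vertex set `V`: an undirected labeling assigning to each
(unordered) pair of vertices a finite set of rational time labels; a pair is an
edge of the graph iff its label set is nonempty. -/
structure TemporalGraph (V : Type*) where
  label : V → V → Finset ℚ
  symm : ∀ u v, label u v = label v u
  loopless : ∀ v, label v v = ∅

namespace TemporalGraph

variable {V : Type*}

/-- The footprint (static underlying graph) of a temporal graph. -/
def footprint (G : TemporalGraph V) : SimpleGraph V where
  Adj u v := (G.label u v).Nonempty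
  symm := ⟨fun u v h => by change (G.label v u).Nonempty; rwa [G.symm]⟩
  loopless := ⟨fun v h => by change (G.label v v).Nonempty at h; rw [G.loopless] at h; exact Finset.not_nonempty_empty h⟩

/-- The snapshot of a temporal graph at time `t`. -/
def snapshot (G : TemporalGraph V) (t : ℚ) : SimpleGraph V where
  Adj u v := t ∈ G.label u v
  symm := ⟨fun u v h => by change t ∈ G.label v u; rwa [G.symm]⟩
  loopless := ⟨fun v h => by change t ∈ G.label v v at h; rw [G.loopless] at h; exact absurd h (Finset.notMem_empty t)⟩

/-- `G.IsTJ r p ts` : the list of vertices `p` together with the list of times `ts`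
(one per consecutive pair of vertices of `p`) forms a temporal walk, i.e. each time
belongs to the labels of the corresponding edge, and consecutive times satisfy `r`
(`r = (· ≤ ·)` for non-strict temporal walks, `r = (· < ·)` for strict ones). -/
inductive IsTJ (G : TemporalGraph V) (r : ℚ → ℚ → Prop) : List V → List ℚ → Prop
  | single (v : V) : IsTJ G r [v] []
  | cons {u v : V} {p : List V} {t : ℚ} {ts : List ℚ} :
      t ∈ G.label u v → IsTJ G r (v :: p) ts →
      (∀ t' ∈ ts.head?, r t t') → IsTJ G r (u :: v :: p) (t :: ts)

/-- A temporal path from `u` to `v` with underlying (vertex-)path `p` and times `ts`. -/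
def TPath (G : TemporalGraph V) (r : ℚ → ℚ → Prop) (u v : V)
    (p : List V) (ts : List ℚ) : Prop :=
  G.IsTJ r p ts ∧ p.Nodup ∧ p.head? = some u ∧ p.getLast? = some v

/-- Temporal reachability. -/
def Reach (G : TemporalGraph V) (r : ℚ → ℚ → Prop) (u v : V) : Prop :=
  ∃ p ts, G.TPath r u v p ts

def TemporallyConnectedRel (G : TemporalGraph V) (r : ℚ → ℚ → Prop) : Prop :=
  ∀ u v : V, u ≠ v → G.Reach r u v

/-- Temporal connectivity (non-strict setting). -/
def TemporallyConnected (G : TemporalGraph V) : Prop :=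
  G.TemporallyConnectedRel (· ≤ ·)

/-- A bidirectional temporal path (bi-path) between `u` and `v` on the underlying
path `p` (from `u` to `v`): a temporal path in each direction along `p`. -/
def BiPath (G : TemporalGraph V) (r : ℚ → ℚ → Prop) (u v : V)
    (p : List V) (ts₁ ts₂ : List ℚ) : Prop :=
  G.TPath r u v p ts₁ ∧ G.TPath r v u p.reverse ts₂

def BiConnectedRel (G : TemporalGraph V) (r : ℚ → ℚ → Prop) : Prop :=
  ∀ u v : V, u ≠ v → ∃ p ts₁ ts₂, G.BiPath r u v p ts₁ ts₂

/-- Bidirectional temporal connectivity (non-strict setting). -/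
def BiConnected (G : TemporalGraph V) : Prop := G.BiConnectedRel (· ≤ ·)

/-- `H` is a temporal subgraph of `G` (on the same vertex set). -/
def IsSubgraph (H G : TemporalGraph V) : Prop := ∀ u v, H.label u v ⊆ G.label u v

/-- A temporal spanner of `G`: a temporally connected temporal subgraph on all of `V`. -/
def IsSpanner (H G : TemporalGraph V) : Prop := H.IsSubgraph G ∧ H.TemporallyConnected

/-- A temporal spanning tree of `G`: a temporal spanner whose footprint is a tree. -/
def IsSpanningTree (H G : TemporalGraph V) : Prop := H.IsSpanner G ∧ H.footprint.IsTree

/-- A bidirectional temporal spanner (bi-spanner) of `G`. -/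
def IsBiSpanner (H G : TemporalGraph V) : Prop := H.IsSpanner G ∧ H.BiConnected

/-- A temporal graph is simple if every edge has exactly one time label,
i.e. every label set has at most one element (edges have nonempty label sets). -/
def Simple (G : TemporalGraph V) : Prop := ∀ u v, (G.label u v).card ≤ 1

/-- A temporal graph is proper if any two (distinct) edges sharing a vertex have
disjoint label sets. -/
def Proper (G : TemporalGraph V) : Prop :=
  ∀ u v w : V, v ≠ w → Disjoint (G.label u v) (G.label u w)

def Happy (G : TemporalGraph V) : Prop := G.Simple ∧ G.Proper

/-- `u` can reach `v` by a (non-strict) temporal path arriving at time at most `t`. -/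
def ArrivesBy (G : TemporalGraph V) (u v : V) (t : ℚ) : Prop :=
  ∃ p ts, G.TPath (· ≤ ·) u v p ts ∧ ∀ t' ∈ ts.getLast?, t' ≤ t

/-- `u` can reach `v` by a (non-strict) temporal path departing at time at least `t`. -/
def DepartsAfter (G : TemporalGraph V) (u v : V) (t : ℚ) : Prop :=
  ∃ p ts, G.TPath (· ≤ ·) u v p ts ∧ ∀ t' ∈ ts.head?, t ≤ t'

/-- A pivot: some time `t` such that every other vertex reaches `x` by time `t`
and `x` reaches every other vertex departing not earlier than `t`. -/
def IsPivot (G : TemporalGraph V) (x : V) : Prop :=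
  ∃ t : ℚ, ∀ u : V, u ≠ x → G.ArrivesBy u x t ∧ G.DepartsAfter x u t

/-- Deleting the (undirected) edge `ab` from a temporal graph. -/
def deleteEdge [DecidableEq V] (G : TemporalGraph V) (a b : V) : TemporalGraph V where
  label u v := if (u = a ∧ v = b) ∨ (u = b ∧ v = a) then ∅ else G.label u v
  symm := by
    intro u v
    have h : ((u = a ∧ v = b) ∨ (u = b ∧ v = a)) ↔ ((v = a ∧ u = b) ∨ (v = b ∧ u = a)) := by
      tauto
    rw [G.symm, if_congr h rfl rfl]
  loopless := by
    intro v
    split_ifs with h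
    · rfl
    · exact G.loopless v

end TemporalGraph

end TemporalPaper

namespace TemporalPaper

open TemporalGraph

/-- Two consecutive edges of a temporal walk carry times related by `r`. -/
theorem TemporalGraph.IsTJ.exists_mem_label_of_consecutive {V : Type*} {G : TemporalGraph V}
    {r : ℚ → ℚ → Prop} {a b c : V} {q : List V} :
    ∀ {l : List V} {ts : List ℚ}, G.IsTJ r (l ++ a :: b :: c :: q) ts →
      ∃ s ∈ G.label a b, ∃ t ∈ G.label b c, r s t
  | [], _, .cons hs (.cons ht _ _) hst => ⟨_, hs, _, ht, hst _ rfl⟩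
  | [_], _, .cons _ h _ => exists_mem_label_of_consecutive (l := []) h
  | _ :: x :: l, _, .cons _ h _ => exists_mem_label_of_consecutive (l := x :: l) h

/-- in a happy temporal graph (non-strict setting), every bi-path between
two distinct vertices has an underlying path consisting of a single edge (2 vertices). -/
theorem stmt6 {V : Type*} [Fintype V] (G : TemporalGraph V) (hG : G.Happy)
    {u v : V} (huv : u ≠ v) {p : List V} {ts₁ ts₂ : List ℚ}
    (h : G.BiPath (· ≤ ·) u v p ts₁ ts₂) :
    p.length = 2 := by
  obtain ⟨hsimple, hproper⟩ := hG
  obtain ⟨⟨hwalk, hnodup, hhead, hlast⟩, hwalk', -⟩ := h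
  match p with
  | [] => simp at hhead
  | [a] => simp_all
  | [_, _] => rfl
  | a :: b :: c :: q =>
    obtain ⟨s, hs, t, ht, hst⟩ := hwalk.exists_mem_label_of_consecutive (l := [])
    have hrev : (a :: b :: c :: q).reverse = q.reverse ++ c :: b :: a :: [] := by simp
    rw [hrev] at hwalk'
    obtain ⟨t', ht', s', hs', hts⟩ := hwalk'.exists_mem_label_of_consecutive
    rw [G.symm] at ht' hs'
    obtain rfl := Finset.card_le_one.mp (hsimple a b) s hs s' hs'
    obtain rfl := Finset.card_le_one.mp (hsimple b c) t ht t' ht'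
    obtain rfl := le_antisymm hst hts
    rw [G.symm] at hs
    have hac : a ≠ c := by rintro rfl; simp at hnodup
    exact absurd ht (Finset.disjoint_left.mp (hproper b a c hac) hs)

end TemporalPaper
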